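/- arXiv:1208.0806 — 2 statements merged into one kernel-verified Lean document; each statement's English description precedes it below -/
import Mathlib

section
/- Let K ≥ 2 and m ≥ 1 be integers, set l := K·m, and for each k ∈ {1,…,K} let n_k be an integer with 0 ≤ n_k ≤ m. Define the combined p-value p := (Σ_{k=1}^K n_k + 1)/(l + 1), the per-fold p-values p_k := (n_k + 1)/(m + 1), and their arithmetic mean p̄ := (1/K) Σ_{k=1}^K p_k. Then p = p̄ + ((K − 1)/(l + 1))·(p̄ − 1). -/
/-- The identity relating the cross-conformal p-value `p` to the arithmetic
mean `p̄` of the per-fold inductive conformal p-values `p_k`, when the `K ≥ 2`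
folds all have the same size `m ≥ 1` and `l = K·m`:
`p = p̄ + ((K − 1)/(l + 1)) · (p̄ − 1)`. -/
theorem cross_conformal_pvalue_identity
    (K m l : ℕ) (hK : 2 ≤ K) (hm : 1 ≤ m) (hl : l = K * m)
    (n : Fin K → ℕ) (hn : ∀ k, n k ≤ m)
    (p : ℝ) (hp : p = ((∑ k, (n k : ℝ)) + 1) / ((l : ℝ) + 1))
    (pk : Fin K → ℝ) (hpk : ∀ k, pk k = ((n k : ℝ) + 1) / ((m : ℝ) + 1))
    (pbar : ℝ) (hpbar : pbar = (1 / (K : ℝ)) * ∑ k, pk k) :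
    p = pbar + (((K : ℝ) - 1) / ((l : ℝ) + 1)) * (pbar - 1) := by
  have hK0 : (K : ℝ) ≠ 0 := by
    have : K ≠ 0 := by omega
    exact_mod_cast this
  have hm0 : (m : ℝ) + 1 ≠ 0 := by positivity
  have hl0 : (K : ℝ) * m + 1 ≠ 0 := by positivity
  have hsum : ∑ k, pk k = ((∑ k, (n k : ℝ)) + K) / ((m : ℝ) + 1) := by
    simp [hpk, ← Finset.sum_div, Finset.sum_add_distrib]
  rw [hp, hpbar, hsum, hl, Nat.cast_mul]
  field_simp
  ring
end

section
/- Under the hypotheses of the previous identity (K ≥ 2, m ≥ 1, l = Km, integers 0 ≤ n_k ≤ m, p := (Σ_{k=1}^K n_k + 1)/(l + 1), p_k := (n_k + 1)/(m + 1), p̄ := (1/K) Σ_{k=1}^K p_k), the combined cross-conformal p-value satisfies |p − p̄| ≤ (K − 1)/(l + 1). In particular p ≤ p̄, and p is close to the average of the per-fold p-values when K is small relative to l. -/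
/-- Under the hypotheses of the cross-conformal p-value identity (`K ≥ 2` folds
of equal size `m ≥ 1`, `l = K·m`, integers `0 ≤ n_k ≤ m`), the cross-conformal
p-value `p` satisfies `|p − p̄| ≤ (K − 1)/(l + 1)`, and in particular `p ≤ p̄`,
where `p̄` is the arithmetic mean of the per-fold p-values `p_k`. -/
theorem cross_conformal_pvalue_close_to_mean
    (K m l : ℕ) (hK : 2 ≤ K) (hm : 1 ≤ m) (hl : l = K * m)
    (n : Fin K → ℕ) (hn : ∀ k, n k ≤ m)
    (p : ℝ) (hp : p = ((∑ k, (n k : ℝ)) + 1) / ((l : ℝ) + 1))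
    (pk : Fin K → ℝ) (hpk : ∀ k, pk k = ((n k : ℝ) + 1) / ((m : ℝ) + 1))
    (pbar : ℝ) (hpbar : pbar = (1 / (K : ℝ)) * ∑ k, pk k) :
    |p - pbar| ≤ ((K : ℝ) - 1) / ((l : ℝ) + 1) ∧ p ≤ pbar := by
  set S : ℝ := ∑ k, (n k : ℝ)
  have hS_nonneg : 0 ≤ S := Finset.sum_nonneg fun k _ => Nat.cast_nonneg _
  have hS_le : S ≤ K * m := by
    calc S ≤ ∑ _k : Fin K, (m : ℝ) := Finset.sum_le_sum fun k _ => Nat.cast_le.mpr (hn k)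
      _ = K * m := by simp
  have hK' : (2 : ℝ) ≤ K := by exact_mod_cast hK
  have hKm : (0 : ℝ) ≤ K * m := by positivity
  have hsum : ∑ k, pk k = (S + K) / ((m : ℝ) + 1) := by
    simp only [hpk, ← Finset.sum_div, Finset.sum_add_distrib]
    simp [S]
  have hdiff : pbar - p =
      ((K : ℝ) - 1) / ((l : ℝ) + 1) * ((K * m - S) / (K * ((m : ℝ) + 1))) := by
    have hl_pos : (0 : ℝ) < K * m + 1 := by positivity
    rw [hpbar, hp, hsum, hl]
    push_cast
    field_simp
    ring
  have hbound_nonneg : 0 ≤ ((K : ℝ) - 1) / ((l : ℝ) + 1) :=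
    div_nonneg (by linarith) (by positivity)
  have hfrac_nonneg : 0 ≤ (K * m - S) / (K * ((m : ℝ) + 1)) :=
    div_nonneg (by linarith) (by positivity)
  have hfrac_le : (K * m - S) / (K * ((m : ℝ) + 1)) ≤ 1 :=
    div_le_one_of_le₀ (by linarith) (by positivity)
  have hle : p ≤ pbar := sub_nonneg.mp (hdiff ▸ mul_nonneg hbound_nonneg hfrac_nonneg)
  refine ⟨?_, hle⟩
  rw [abs_sub_comm, abs_of_nonneg (sub_nonneg.mpr hle), hdiff]
  exact mul_le_of_le_one_right hbound_nonneg hfrac_le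
end
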